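/- arXiv:2408.16199 — 2 statements merged into one kernel-verified Lean document; each statement's English description precedes it below -/
import Mathlib

section
/- Let R be an order of a number field E. The map sending the Cl(R)-orbit of the class of a fractional R-ideal I to the family ([I ⊗_R R_w])_w, indexed by the maximal ideals w of R, is a well-defined bijection from Cl(R)∖ClBar(R) onto the product ∏_w ClBar(R_w) (where I ⊗_R R_w is identified with its image in E_w, a fractional R_w-ideal, and for all but finitely many w this image is the class of R_w itself). -/
open scoped Classical TensorProduct

set_option synthInstance.maxHeartbeats 1000000
set_option maxHeartbeats 1600000

noncomputable section

section Completion

variable {A : Type*} [CommRing A] [IsNoetherianRing A] (w : Ideal A)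

/-- The extension of `w` to the `w`-adic completion. -/
abbrev extIdeal : Ideal (AdicCompletion w A) := w.map (algebraMap A (AdicCompletion w A))

lemma isAdicComplete_extIdeal : IsAdicComplete (extIdeal w) (AdicCompletion w A) :=
  AdicCompletion.isAdicComplete_self w (IsNoetherian.noetherian w)

lemma extIdeal_le_jacobson : extIdeal w ≤ Ideal.jacobson ⊥ :=
  have := isAdicComplete_extIdeal w
  IsAdicComplete.le_jacobson_bot _

lemma mem_extIdeal_pow_iff (n : ℕ) (x : AdicCompletion w A) :
    x ∈ extIdeal w ^ n ↔ AdicCompletion.eval w A n x = 0 := by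
  have h := AdicCompletion.pow_smul_top_eq_ker_eval (M := A) (n := n) (IsNoetherian.noetherian w)
  have h2 : x ∈ (w ^ n • ⊤ : Submodule A (AdicCompletion w A)) ↔ x ∈ extIdeal w ^ n := by
    rw [Ideal.smul_top_eq_map, Submodule.restrictScalars_mem, Ideal.map_pow]
  rw [← h2, h, LinearMap.mem_ker]

lemma algebraMap_mem_extIdeal_pow_iff (n : ℕ) (a : A) :
    algebraMap A (AdicCompletion w A) a ∈ extIdeal w ^ n ↔ a ∈ w ^ n := by
  rw [mem_extIdeal_pow_iff]
  have : AdicCompletion.eval w A n (algebraMap A (AdicCompletion w A) a) =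
      Submodule.Quotient.mk a := rfl
  rw [this, Submodule.Quotient.mk_eq_zero]
  simp

lemma exists_sub_mem_extIdeal_pow (n : ℕ) (x : AdicCompletion w A) :
    ∃ a : A, x - algebraMap A (AdicCompletion w A) a ∈ extIdeal w ^ n := by
  obtain ⟨a, ha⟩ := Submodule.Quotient.mk_surjective _ (AdicCompletion.eval w A n x)
  refine ⟨a, ?_⟩
  rw [mem_extIdeal_pow_iff, map_sub, ← ha]
  exact sub_self _

lemma isUnit_algebraMap_of_notMem [w.IsMaximal] {a : A} (ha : a ∉ w) :
    IsUnit (algebraMap A (AdicCompletion w A) a) := by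
  obtain ⟨b, c, hc, h⟩ := Ideal.IsMaximal.exists_inv ‹w.IsMaximal› ha
  have hj := extIdeal_le_jacobson w (Ideal.mem_map_of_mem _ hc)
  have hu := Ideal.mem_jacobson_bot.1 hj (-1)
  have : algebraMap A (AdicCompletion w A) c * -1 + 1 =
      algebraMap A (AdicCompletion w A) b * algebraMap A (AdicCompletion w A) a := by
    rw [← map_mul, eq_sub_of_add_eq h]; simp; ring
  rw [this] at hu
  exact isUnit_of_mul_isUnit_right hu

/-- Locally at `w`, a high power of `w` is divisible by a given nonzero element. -/
lemma exists_pow_dvd [IsDomain A] [Ring.DimensionLEOne A] [w.IsMaximal] {d : A} (hd : d ≠ 0) :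
    ∃ N : ℕ, ∃ s ∉ w, ∀ x ∈ w ^ N, d ∣ s * x := by
  by_cases hdw : d ∉ w
  · exact ⟨0, d, hdw, fun x _ => dvd_mul_right _ _⟩
  rw [not_not] at hdw
  have hart : IsArtinianRing (A ⧸ Ideal.span {d}) := by
    rw [isArtinianRing_iff_isNoetherianRing_krullDimLE_zero]
    refine ⟨inferInstance, Ring.KrullDimLE.mk₀ fun q hq => ?_⟩
    have hle : Ideal.span {d} ≤ q.comap (Ideal.Quotient.mk (Ideal.span {d})) := by
      rw [Ideal.span_le, Set.singleton_subset_iff]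
      simp
    have hmax : (q.comap (Ideal.Quotient.mk (Ideal.span {d}))).IsMaximal := by
      refine Ideal.IsPrime.isMaximal inferInstance fun h => hd ?_
      have := hle (Ideal.mem_span_singleton_self d)
      rwa [h] at this
    rw [← Ideal.map_comap_of_surjective _ Ideal.Quotient.mk_surjective q]
    exact Ideal.IsMaximal.map_of_surjective_of_ker_le Ideal.Quotient.mk_surjective
      (by rwa [Ideal.mk_ker])
  let π := Ideal.Quotient.mk (Ideal.span {d})
  obtain ⟨N, hN⟩ := IsArtinian.monotone_stabilizes
    ⟨fun n => OrderDual.toDual (w.map π ^ n), fun a b h => Ideal.pow_le_pow_right h⟩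
  have hN' : w.map π ^ N = w.map π ^ (N + 1) := congrArg OrderDual.ofDual (hN (N + 1) (by omega))
  obtain ⟨r, hr1, hr⟩ := Submodule.exists_sub_one_mem_and_smul_eq_zero_of_fg_of_le_smul
    (w.map π) (w.map π ^ N) (IsNoetherian.noetherian _)
    (by rw [smul_eq_mul, ← pow_succ']; exact hN'.le)
  obtain ⟨s, rfl⟩ := Ideal.Quotient.mk_surjective r
  refine ⟨N, s, fun hs => ?_, fun x hx => ?_⟩
  · have h1 : π (s - 1) ∈ w.map π := by simpa [π] using hr1
    rw [Ideal.mem_map_iff_of_surjective _ Ideal.Quotient.mk_surjective] at h1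
    obtain ⟨y, hy, hys⟩ := h1
    rw [Ideal.Quotient.eq, Ideal.mem_span_singleton] at hys
    have h2 : y - (s - 1) ∈ w := Ideal.mem_of_dvd _ hys hdw
    have : (1 : A) ∈ w := by
      have := sub_mem (add_mem h2 hs) hy
      ring_nf at this
      exact this
    exact (Ideal.ne_top_iff_one w).1 (Ideal.IsMaximal.ne_top ‹_›) this
  · have := hr (π x) (by rw [← Ideal.map_pow]; exact Ideal.mem_map_of_mem _ hx)
    rw [smul_eq_mul, ← map_mul, Ideal.Quotient.eq_zero_iff_mem] at this
    exact Ideal.mem_span_singleton.1 this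

lemma extIdeal_pow_le_span [IsDomain A] [Ring.DimensionLEOne A] [w.IsMaximal] {d : A}
    (hd : d ≠ 0) :
    ∃ N : ℕ, extIdeal w ^ N ≤ Ideal.span {algebraMap A (AdicCompletion w A) d} := by
  obtain ⟨N, s, hs, h⟩ := exists_pow_dvd w hd
  refine ⟨N, ?_⟩
  rw [← Ideal.map_pow, Ideal.map_le_iff_le_comap]
  intro x hx
  rw [Ideal.mem_comap, Ideal.mem_span_singleton]
  rw [← (isUnit_algebraMap_of_notMem w hs).dvd_mul_left, ← map_mul]
  exact map_dvd _ (h x hx)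

lemma isMaximal_extIdeal [w.IsMaximal] : (extIdeal w).IsMaximal :=
  AdicCompletion.isMaximal_map_of_le w w le_rfl (IsNoetherian.noetherian w)

lemma isPrecomplete_pi {B : Type*} [CommRing B] (I : Ideal B) [IsPrecomplete I B] (ι : Type*)
    [Fintype ι] : IsPrecomplete I (ι → B) := by
  have key : ∀ (n : ℕ) (v : ι → B),
      v ∈ (I ^ n • ⊤ : Submodule B (ι → B)) ↔ ∀ i, v i ∈ I ^ n := by
    intro n v
    constructor
    · intro hv i
      refine Submodule.smul_induction_on hv (fun r hr x _ => ?_) (fun x y hx hy => ?_)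
      · exact Ideal.mul_mem_right _ _ hr
      · exact add_mem hx hy
    · intro hv
      rw [pi_eq_sum_univ' v]
      exact Submodule.sum_mem _ fun i _ => Submodule.smul_mem_smul (hv i) trivial
  refine ⟨fun f hf => ?_⟩
  have h : ∀ i, ∃ L : B, ∀ n, f n i ≡ L [SMOD (I ^ n • ⊤ : Submodule B B)] := by
    intro i
    refine IsPrecomplete.prec ‹_› (f := fun n => f n i) fun {m n} hmn => ?_
    have := hf hmn
    rw [SModEq.sub_mem, key] at this
    rw [SModEq.sub_mem]
    simpa using this i
  choose L hL using h
  refine ⟨L, fun n => ?_⟩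
  rw [SModEq.sub_mem, key]
  intro i
  have := hL i n
  rw [SModEq.sub_mem] at this
  simpa using this

lemma isNoetherianRing_adicCompletion [IsDomain A] [Ring.DimensionLEOne A] [w.IsMaximal]
    (hw : w ≠ ⊥) : IsNoetherianRing (AdicCompletion w A) := by
  obtain ⟨p, hpw, hp⟩ := Submodule.exists_mem_ne_zero_of_ne_bot hw
  obtain ⟨N, hN⟩ := extIdeal_pow_le_span w hp
  set B := AdicCompletion w A
  set m : Ideal B := extIdeal w
  set ϖ : B := algebraMap A B p
  have hϖ : ϖ ∈ m := Ideal.mem_map_of_mem _ hpw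
  have hcomplete : IsAdicComplete m B := isAdicComplete_extIdeal w
  have hmmax : m.IsMaximal := isMaximal_extIdeal w
  have hmfg : m.FG := Ideal.FG.map (IsNoetherian.noetherian w) _
  have hquot : IsNoetherianRing (B ⧸ Ideal.span {ϖ}) := by
    have : Function.Surjective ((Ideal.Quotient.mk (Ideal.span {ϖ})).comp (algebraMap A B)) := by
      intro x
      obtain ⟨x, rfl⟩ := Ideal.Quotient.mk_surjective x
      obtain ⟨a, ha⟩ := exists_sub_mem_extIdeal_pow w N x
      exact ⟨a, ((Ideal.Quotient.eq).2 (hN ha)).symm⟩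
    exact isNoetherianRing_of_surjective _ _ _ this
  refine IsNoetherianRing.of_prime fun q hq => ?_
  by_cases hϖq : ϖ ∈ q
  · have : m ≤ q := by
      refine Ideal.IsPrime.le_of_pow_le (n := N) (hN.trans ?_)
      rwa [Ideal.span_le, Set.singleton_subset_iff]
    rwa [← hmmax.eq_of_le hq.ne_top this]
  have himg : (q.map (Ideal.Quotient.mk (Ideal.span {ϖ}))).FG := IsNoetherian.noetherian _
  obtain ⟨s, hs, hsq⟩ : ∃ s : Finset B, (s : Set B) ⊆ q ∧ q ≤ Ideal.span s ⊔ Ideal.span {ϖ} := by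
    replace himg := (Submodule.fg_span_iff_fg_span_finset_subset _).1 himg
    obtain ⟨t, ht, hspan⟩ := himg
    obtain ⟨s, hs, rfl⟩ := Finset.subset_set_image_iff.1 ht
    refine ⟨s, hs, ?_⟩
    have h1 : q.map (Ideal.Quotient.mk (Ideal.span {ϖ})) =
        (Ideal.span (s : Set B)).map (Ideal.Quotient.mk (Ideal.span {ϖ})) := by
      rw [Ideal.map_span, ← Finset.coe_image]
      exact hspan
    have h2 := Ideal.le_comap_map (f := Ideal.Quotient.mk (Ideal.span {ϖ})) (I := q)
    rwa [h1, Ideal.comap_map_of_surjective' _ Ideal.Quotient.mk_surjective, Ideal.mk_ker] at h2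
  have hhaus : IsHausdorff m q := by
    refine ⟨fun x hx => ?_⟩
    refine Subtype.ext (IsHausdorff.haus hcomplete.toIsHausdorff (x : B) fun n => ?_)
    have h1 := SModEq.zero.1 (hx n)
    rw [SModEq.zero]
    have h2 := Submodule.mem_map_of_mem (f := q.subtype) h1
    rw [Submodule.map_smul''] at h2
    exact Submodule.smul_mono le_rfl le_top h2
  have hpre := isPrecomplete_pi m s
  have hsurj := surjective_of_mkQ_comp_surjective (I := m)
    (f := Fintype.linearCombination B (fun i : s => (⟨i, hs i.2⟩ : q))) fun y => by
      obtain ⟨⟨x, hx⟩, rfl⟩ := Submodule.Quotient.mk_surjective _ y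
      obtain ⟨a, ha, c, hc, rfl⟩ := Submodule.mem_sup.1 (hsq hx)
      obtain ⟨b, rfl⟩ := Ideal.mem_span_singleton'.1 hc
      have haq : a ∈ q := Ideal.span_le.2 hs ha
      have hbq : b ∈ q := (hq.mem_or_mem ((Ideal.add_mem_iff_right _ haq).1 hx)).resolve_right hϖq
      obtain ⟨v, hv⟩ := (Submodule.mem_span_finset'.1 ha)
      refine ⟨v, ?_⟩
      rw [LinearMap.comp_apply, Submodule.mkQ_apply, Submodule.Quotient.eq]
      have : Fintype.linearCombination B (fun i : s => (⟨i, hs i.2⟩ : q)) v -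
          ⟨a + b * ϖ, hx⟩ = -(ϖ • (⟨b, hbq⟩ : q)) := by
        refine Subtype.ext ?_
        simp [Fintype.linearCombination_apply, ← hv, mul_comm ϖ b]
        exact sub_add_cancel_left _ _
      rw [this]
      exact neg_mem (Submodule.smul_mem_smul hϖ trivial)
  exact Module.Finite.iff_fg.1 (Module.Finite.of_surjective _ hsurj)

/-- The completion of a one-dimensional domain at a maximal ideal has dimension at most one, so
every non-zero-divisor divides a nonzero element of the domain. -/
lemma exists_dvd_algebraMap [IsDomain A] [Ring.DimensionLEOne A] [w.IsMaximal] (hw : w ≠ ⊥)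
    {r : AdicCompletion w A} (hr : r ∈ nonZeroDivisors (AdicCompletion w A)) :
    ∃ d : A, d ≠ 0 ∧ r ∣ algebraMap A (AdicCompletion w A) d := by
  have := isNoetherianRing_adicCompletion w hw
  obtain ⟨p, hpw, hp⟩ := Submodule.exists_mem_ne_zero_of_ne_bot hw
  obtain ⟨N, hN⟩ := extIdeal_pow_le_span w hp
  have hmmax : (extIdeal w).IsMaximal := isMaximal_extIdeal w
  have hprime : (extIdeal w).IsPrime := hmmax.isPrime
  have hmax : ∀ q : Ideal (AdicCompletion w A), q.IsPrime →
      algebraMap A (AdicCompletion w A) p ∈ q → q = extIdeal w := by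
    intro q hq hpq
    refine (hmmax.eq_of_le hq.ne_top (Ideal.IsPrime.le_of_pow_le (n := N) (hN.trans ?_))).symm
    rwa [Ideal.span_le, Set.singleton_subset_iff]
  have hheight : (extIdeal w).height ≤ 1 := by
    refine Ideal.height_le_one_of_isPrincipal_of_mem_minimalPrimes
      (Ideal.span {algebraMap A (AdicCompletion w A) p}) _ ⟨⟨hprime, ?_⟩, ?_⟩
    · rw [Ideal.span_le, Set.singleton_subset_iff]
      exact Ideal.mem_map_of_mem _ hpw
    · rintro q ⟨hq, hle⟩ -
      exact (hmax q hq (hle (Ideal.mem_span_singleton_self _))).ge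
  have hrad : algebraMap A (AdicCompletion w A) p ∈ (Ideal.span {r}).radical := by
    rw [Ideal.radical_eq_sInf, Submodule.mem_sInf]
    rintro q ⟨hrq, hq⟩
    rw [Ideal.span_le, Set.singleton_subset_iff] at hrq
    have hqle : q ≤ extIdeal w := by
      have := isAdicComplete_extIdeal w
      have hl := isLocalRing_of_isAdicComplete_maximal (extIdeal w)
      rw [IsLocalRing.eq_maximalIdeal hmmax]
      exact IsLocalRing.le_maximalIdeal hq.ne_top
    rcases hqle.eq_or_lt with h | h
    · exact h ▸ Ideal.mem_map_of_mem _ hpw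
    · exfalso
      have h1 : Ideal.height q = 0 := by
        simpa using (Ideal.height_strict_mono_of_isPrime h).trans_le hheight
      exact Set.disjoint_left.1 (Ideal.disjoint_nonZeroDivisors_of_mem_minimalPrimes
        (Ideal.height_eq_zero_iff.1 h1)) hrq hr
  obtain ⟨n, hn⟩ := hrad
  refine ⟨p ^ n, pow_ne_zero _ hp, ?_⟩
  rw [map_pow]
  exact Ideal.mem_span_singleton.1 hn

end Completion

section FractionField

variable {A : Type*} [CommRing A] {K : Type*} [Field K] [Algebra A K] (w : Ideal A)

/-- The extension of an `A`-submodule of `K` to the completion of `K` at `w`. -/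
def locAt (M : Submodule A K) :
    Submodule (AdicCompletion w A) (AdicCompletion w A ⊗[A] K) :=
  Submodule.span (AdicCompletion w A)
    ((fun x : K => (1 : AdicCompletion w A) ⊗ₜ[A] x) '' (M : Set K))

/-- The canonical map from `K` to its completion at `w`. -/
abbrev toCompl : K →ₐ[A] AdicCompletion w A ⊗[A] K := Algebra.TensorProduct.includeRight

variable {w} in
lemma toCompl_mem_locAt {M : Submodule A K} {x : K} (hx : x ∈ M) : toCompl w x ∈ locAt w M :=
  Submodule.subset_span ⟨x, hx, rfl⟩

lemma locAt_le_iff {M : Submodule A K}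
    {N : Submodule (AdicCompletion w A) (AdicCompletion w A ⊗[A] K)} :
    locAt w M ≤ N ↔ ∀ x ∈ M, toCompl w x ∈ N := by
  rw [locAt, Submodule.span_le, Set.image_subset_iff]
  rfl

lemma toCompl_algebraMap (a : A) :
    toCompl w (algebraMap A K a) =
      algebraMap (AdicCompletion w A) (AdicCompletion w A ⊗[A] K) (algebraMap A _ a) := by
  rw [AlgHom.commutes]
  exact IsScalarTower.algebraMap_apply A (AdicCompletion w A) (AdicCompletion w A ⊗[A] K) a

lemma toCompl_smul (a : A) (x : K) :
    toCompl w (a • x) = algebraMap A (AdicCompletion w A) a • toCompl w x := by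
  rw [map_smul, algebraMap_smul]

lemma isUnit_toCompl {x : K} (hx : x ≠ 0) : IsUnit (toCompl w x) :=
  (IsUnit.mk0 x hx).map _

lemma map_mulLeft_locAt (x : K) (M : Submodule A K) :
    (locAt w M).map (LinearMap.mulLeft (AdicCompletion w A) (toCompl w x)) =
      locAt w (M.map (LinearMap.mulLeft A x)) := by
  rw [locAt, locAt, Submodule.map_span, Submodule.map_coe, Set.image_image, Set.image_image]
  congr 1
  refine Set.image_congr fun y _ => ?_
  simp

lemma locAt_fg {M : Submodule A K} (hM : M.FG) : (locAt w M).FG := by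
  obtain ⟨s, rfl⟩ := hM
  refine ⟨s.image (toCompl w), le_antisymm ?_ ?_⟩
  · rw [Submodule.span_le, Finset.coe_image, Set.image_subset_iff]
    exact fun x hx => toCompl_mem_locAt (Submodule.subset_span hx)
  · rw [locAt_le_iff]
    intro x hx
    induction hx using Submodule.span_induction with
    | mem x hx => exact Submodule.subset_span (by simpa using ⟨x, hx, rfl⟩)
    | zero => simp
    | add x y _ _ hx hy => rw [map_add]; exact add_mem hx hy
    | smul a x _ hx => rw [toCompl_smul]; exact Submodule.smul_mem _ _ hx

lemma locAt_one : locAt w (1 : Submodule A K) =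
    Submodule.span (AdicCompletion w A) {(1 : AdicCompletion w A ⊗[A] K)} := by
  refine le_antisymm ((locAt_le_iff w).2 fun x hx => ?_) ?_
  · obtain ⟨a, rfl⟩ := Submodule.mem_one.1 hx
    rw [toCompl_algebraMap, Algebra.algebraMap_eq_smul_one]
    exact Submodule.smul_mem _ _ (Submodule.mem_span_singleton_self _)
  · rw [Submodule.span_le, Set.singleton_subset_iff]
    have : (1 : K) ∈ (1 : Submodule A K) := Submodule.one_le.1 le_rfl
    have h := toCompl_mem_locAt (w := w) this
    rwa [map_one] at h

variable [IsNoetherianRing A]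

lemma locAt_mono_of_local [w.IsMaximal] {M N : Submodule A K}
    (h : ∀ x ∈ M, ∃ s ∉ w, s • x ∈ N) : locAt w M ≤ locAt w N := by
  rw [locAt_le_iff]
  intro x hx
  obtain ⟨s, hs, hsx⟩ := h x hx
  have h1 := toCompl_mem_locAt (w := w) hsx
  rw [toCompl_smul] at h1
  obtain ⟨v, hv⟩ := isUnit_algebraMap_of_notMem w hs
  rw [← hv] at h1
  exact (Submodule.smul_mem_iff_of_isUnit _ v.isUnit).1 h1

variable [IsFractionRing A K]

lemma algebraMap_compl_injective : Function.Injective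
    (algebraMap (AdicCompletion w A) (AdicCompletion w A ⊗[A] K)) :=
  Algebra.TensorProduct.includeLeft_injective (S := AdicCompletion w A)
    (IsFractionRing.injective A K)

lemma nontrivial_compl [w.IsMaximal] : Nontrivial (AdicCompletion w A ⊗[A] K) := by
  have : Nontrivial (AdicCompletion w A) :=
    (AdicCompletion.evalOneₐ_surjective w).nontrivial
  exact (algebraMap_compl_injective (K := K) w).nontrivial

variable [IsDomain A]

omit [IsNoetherianRing A] in
lemma exists_smul_mem_range (u : AdicCompletion w A ⊗[A] K) :
    ∃ n : A, n ≠ 0 ∧ ∃ r : AdicCompletion w A,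
      toCompl w (algebraMap A K n) * u = algebraMap _ _ r := by
  induction u with
  | zero => exact ⟨1, one_ne_zero, 0, by simp⟩
  | tmul r x =>
    obtain ⟨a, b, hb, rfl⟩ := IsFractionRing.div_surjective (A := A) x
    have hb0 : algebraMap A K b ≠ 0 := by simpa using nonZeroDivisors.ne_zero hb
    refine ⟨b, nonZeroDivisors.ne_zero hb, r * algebraMap A _ a, ?_⟩
    have h : r ⊗ₜ[A] (algebraMap A K a / algebraMap A K b) =
        algebraMap _ (AdicCompletion w A ⊗[A] K) r *
          toCompl w (algebraMap A K a / algebraMap A K b) := by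
      simp
    rw [h, mul_left_comm, ← map_mul (toCompl w), mul_div_cancel₀ _ hb0, toCompl_algebraMap, map_mul]
  | add u v hu hv =>
    obtain ⟨m, hm, r, hr⟩ := hu
    obtain ⟨n, hn, s, hs⟩ := hv
    refine ⟨m * n, mul_ne_zero hm hn, algebraMap A _ n * r + algebraMap A _ m * s, ?_⟩
    simp only [map_mul, map_add, ← hr, ← hs, ← toCompl_algebraMap]
    ring

variable [Ring.DimensionLEOne A]

/-- `K` is dense in its completion. -/
lemma exists_sub_toCompl [w.IsMaximal] {d : A} (hd : d ≠ 0) (u : AdicCompletion w A ⊗[A] K) :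
    ∃ (x : K) (r : AdicCompletion w A),
      u - toCompl w x = algebraMap _ _ (algebraMap A _ d * r) := by
  obtain ⟨n, hn, r₀, hr₀⟩ := exists_smul_mem_range w u
  obtain ⟨N, hN⟩ := extIdeal_pow_le_span w (mul_ne_zero hn hd)
  obtain ⟨a, ha⟩ := exists_sub_mem_extIdeal_pow w N r₀
  obtain ⟨r, hr⟩ := Ideal.mem_span_singleton'.1 (hN ha)
  have hn' : algebraMap A K n ≠ 0 := by simpa using hn
  refine ⟨algebraMap A K a / algebraMap A K n, r, ?_⟩
  refine (isUnit_toCompl w hn').mul_left_cancel ?_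
  rw [mul_sub, hr₀, ← map_mul, mul_div_cancel₀ _ hn', toCompl_algebraMap, toCompl_algebraMap,
    ← map_sub, ← hr, ← map_mul]
  congr 1
  rw [map_mul]
  ring

lemma exists_smul_eq_of_toCompl [w.IsMaximal] {d : A} (hd : d ≠ 0) {z : K}
    {r : AdicCompletion w A} (h : toCompl w z = algebraMap _ _ (algebraMap A _ d * r)) :
    ∃ s ∉ w, ∃ c : A, s • z = algebraMap A K (d * c) := by
  obtain ⟨a, b, hb, rfl⟩ := IsFractionRing.div_surjective (A := A) z
  have hb0 : b ≠ 0 := nonZeroDivisors.ne_zero hb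
  have hbK : algebraMap A K b ≠ 0 := by simpa using hb0
  have h1 : algebraMap A (AdicCompletion w A) a = algebraMap A _ (b * d) * r := by
    apply algebraMap_compl_injective (K := K) w
    rw [← toCompl_algebraMap, map_mul _ b d, mul_assoc, map_mul, ← h, ← toCompl_algebraMap,
      ← map_mul, mul_div_cancel₀ _ hbK]
  obtain ⟨N, s, hs, hN⟩ := exists_pow_dvd w (mul_ne_zero hb0 hd)
  obtain ⟨c, hc⟩ := exists_sub_mem_extIdeal_pow w N r
  have h2 : a - b * d * c ∈ w ^ N := by
    rw [← algebraMap_mem_extIdeal_pow_iff, map_sub, map_mul _ (b * d) c, h1, ← mul_sub]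
    exact Ideal.mul_mem_left _ _ hc
  obtain ⟨e, he⟩ := hN _ h2
  refine ⟨s, hs, s * c + e, ?_⟩
  rw [Algebra.smul_def, mul_div_assoc', div_eq_iff hbK, ← map_mul, ← map_mul]
  congr 1
  linear_combination he

omit [IsNoetherianRing A] [Ring.DimensionLEOne A] in
lemma exists_smul_integral {M : Submodule A K} (hM : M.FG) :
    ∃ e : A, e ≠ 0 ∧ ∀ x ∈ M, ∃ a : A, e • x = algebraMap A K a := by
  obtain ⟨e, he, h⟩ := FractionalIdeal.isFractional_of_fg (S := nonZeroDivisors A) hM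
  exact ⟨e, nonZeroDivisors.ne_zero he, fun x hx => (h x hx).imp fun _ ha => ha.symm⟩

omit [Ring.DimensionLEOne A] in
lemma fg_of_smul_integral {M : Submodule A K} {e : A} (he : e ≠ 0)
    (h : ∀ x ∈ M, ∃ a : A, e • x = algebraMap A K a) : M.FG :=
  FractionalIdeal.fg_of_isNoetherianRing (S := nonZeroDivisors A) le_rfl
    ⟨M, e, mem_nonZeroDivisors_of_ne_zero he, fun x hx => (h x hx).imp fun _ ha => ha.symm⟩

omit [IsNoetherianRing A] [Ring.DimensionLEOne A] in
lemma exists_algebraMap_mem {M : Submodule A K} (hM : M ≠ ⊥) :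
    ∃ d : A, d ≠ 0 ∧ algebraMap A K d ∈ M := by
  obtain ⟨x, hx, hx0⟩ := Submodule.exists_mem_ne_zero_of_ne_bot hM
  obtain ⟨a, b, hb, rfl⟩ := IsFractionRing.div_surjective (A := A) x
  have hbK : algebraMap A K b ≠ 0 := by simpa using nonZeroDivisors.ne_zero hb
  refine ⟨a, fun h => hx0 (by simp [h]), ?_⟩
  have := M.smul_mem b hx
  rwa [Algebra.smul_def, mul_div_cancel₀ _ hbK] at this

omit [IsNoetherianRing A] [IsFractionRing A K] [IsDomain A] [Ring.DimensionLEOne A] in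
lemma compl_smul_def (r : AdicCompletion w A) (v : AdicCompletion w A ⊗[A] K) :
    r • v = algebraMap _ (AdicCompletion w A ⊗[A] K) r * v :=
  Algebra.smul_def r v

lemma exists_sub_of_mem_locAt [w.IsMaximal] {M : Submodule A K} (hM : M.FG) {d : A} (hd : d ≠ 0)
    {v : AdicCompletion w A ⊗[A] K} (hv : v ∈ locAt w M) :
    ∃ x ∈ M, ∃ r : AdicCompletion w A,
      v - toCompl w x = algebraMap _ _ (algebraMap A _ d * r) := by
  obtain ⟨e, he, hint⟩ := exists_smul_integral hM
  obtain ⟨N, hN⟩ := extIdeal_pow_le_span w (mul_ne_zero hd he)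
  rw [locAt] at hv
  induction hv using Submodule.span_induction with
  | mem v hv =>
    obtain ⟨x, hx, rfl⟩ := hv
    exact ⟨x, hx, 0, by simp⟩
  | zero => exact ⟨0, zero_mem _, 0, by simp⟩
  | add u v _ _ hu hv =>
    obtain ⟨x, hx, r, hr⟩ := hu
    obtain ⟨y, hy, s, hs⟩ := hv
    refine ⟨x + y, add_mem hx hy, r + s, ?_⟩
    rw [map_add, mul_add, map_add, ← hr, ← hs]
    ring
  | smul t v _ hv =>
    obtain ⟨x, hx, r, hr⟩ := hv
    obtain ⟨a, ha⟩ := exists_sub_mem_extIdeal_pow w N t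
    obtain ⟨q, hq⟩ := Ideal.mem_span_singleton'.1 (hN ha)
    obtain ⟨b, hb⟩ := hint x hx
    refine ⟨a • x, M.smul_mem _ hx, q * algebraMap A _ b + t * r, ?_⟩
    have hb' := congrArg (toCompl w) hb
    rw [toCompl_smul, toCompl_algebraMap] at hb'
    rw [toCompl_smul, eq_add_of_sub_eq hr, eq_add_of_sub_eq hq.symm]
    simp only [compl_smul_def, map_add, map_mul] at hb' ⊢
    linear_combination (algebraMap _ (AdicCompletion w A ⊗[A] K) q *
      algebraMap _ (AdicCompletion w A ⊗[A] K) (algebraMap A (AdicCompletion w A) d)) * hb'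

lemma exists_smul_mem_of_toCompl_mem [w.IsMaximal] {M : Submodule A K} (hM : M.FG) (hM0 : M ≠ ⊥)
    {y : K} (hy : toCompl w y ∈ locAt w M) : ∃ s ∉ w, s • y ∈ M := by
  obtain ⟨d, hd, hdM⟩ := exists_algebraMap_mem hM0
  obtain ⟨x, hx, r, hr⟩ := exists_sub_of_mem_locAt w hM hd hy
  rw [← map_sub] at hr
  obtain ⟨s, hs, c, hc⟩ := exists_smul_eq_of_toCompl w hd hr
  refine ⟨s, hs, ?_⟩
  have : s • y = s • x + c • algebraMap A K d := by
    rw [smul_sub] at hc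
    rw [eq_add_of_sub_eq hc, Algebra.smul_def c, map_mul]
    ring
  rw [this]
  exact add_mem (M.smul_mem _ hx) (M.smul_mem _ hdM)

/-- Two lattices in `K` whose completions differ by a unit differ locally by an element of `K`. -/
lemma exists_locAt_scale_eq [w.IsMaximal] (hw : w ≠ ⊥) {I J : Submodule A K} (hI : I.FG)
    (hJ : J.FG) (hJ0 : J ≠ ⊥) {u : AdicCompletion w A ⊗[A] K}
    (hu : (locAt w I).map (LinearMap.mulLeft (AdicCompletion w A) u) = locAt w J) :
    ∃ x : K, x ≠ 0 ∧ locAt w (I.map (LinearMap.mulLeft A x)) = locAt w J := by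
  obtain ⟨e, he, hint⟩ := exists_smul_integral hI
  obtain ⟨b, hb, hbJ⟩ := exists_algebraMap_mem hJ0
  obtain ⟨p, hpw, hp⟩ := Submodule.exists_mem_ne_zero_of_ne_bot hw
  obtain ⟨x, r, hr⟩ := exists_sub_toCompl w (mul_ne_zero (mul_ne_zero he hb) hp) u
  have hloc : ∀ v ∈ locAt w I, (u - toCompl w x) * v ∈ extIdeal w • locAt w J := by
    intro v hv
    rw [locAt] at hv
    induction hv using Submodule.span_induction with
    | mem v hv =>
      obtain ⟨y, hy, rfl⟩ := hv
      obtain ⟨a, ha⟩ := hint y hy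
      have ha' := congrArg (toCompl w) ha
      rw [toCompl_smul, toCompl_algebraMap, compl_smul_def] at ha'
      have h1 : (u - toCompl w x) * toCompl w y =
          algebraMap A (AdicCompletion w A) p •
            ((r * algebraMap A (AdicCompletion w A) a) • toCompl w (algebraMap A K b)) := by
        rw [hr, toCompl_algebraMap]
        simp only [compl_smul_def, map_mul]
        linear_combination (algebraMap _ (AdicCompletion w A ⊗[A] K) r *
          algebraMap _ (AdicCompletion w A ⊗[A] K) (algebraMap A (AdicCompletion w A) b) *
          algebraMap _ (AdicCompletion w A ⊗[A] K) (algebraMap A (AdicCompletion w A) p)) * ha'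
      exact h1 ▸ Submodule.smul_mem_smul (Ideal.mem_map_of_mem _ hpw)
        (Submodule.smul_mem _ _ (toCompl_mem_locAt hbJ))
    | zero => simp
    | add v v' _ _ hv hv' => rw [mul_add]; exact add_mem hv hv'
    | smul t v _ hv => rw [mul_smul_comm]; exact Submodule.smul_mem _ _ hv
  have h1 : locAt w (I.map (LinearMap.mulLeft A x)) ≤ locAt w J := by
    rw [← map_mulLeft_locAt, Submodule.map_le_iff_le_comap]
    intro v hv
    have h2 : u * v ∈ locAt w J := hu ▸ Submodule.mem_map_of_mem hv
    have h3 := sub_mem h2 (Submodule.smul_le_right (hloc v hv))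
    rwa [sub_mul, sub_sub_cancel] at h3
  have h2 : locAt w J ≤ locAt w (I.map (LinearMap.mulLeft A x)) := by
    refine Submodule.le_of_le_smul_of_le_jacobson_bot (locAt_fg w hJ) (extIdeal_le_jacobson w) ?_
    conv_lhs => rw [← hu]
    rw [← map_mulLeft_locAt, Submodule.map_le_iff_le_comap]
    intro v hv
    have h3 : u * v = toCompl w x * v + (u - toCompl w x) * v := by ring
    rw [Submodule.mem_comap, LinearMap.mulLeft_apply, h3]
    exact add_mem (Submodule.mem_sup_left (Submodule.mem_map_of_mem hv))
      (Submodule.mem_sup_right (hloc v hv))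
  refine ⟨x, ?_, le_antisymm h1 h2⟩
  rintro rfl
  have h3 := h2 (toCompl_mem_locAt hbJ)
  rw [← map_mulLeft_locAt, map_zero] at h3
  obtain ⟨v, -, hv⟩ := h3
  have := nontrivial_compl (K := K) w
  have hbK : algebraMap A K b ≠ 0 := by simpa using hb
  refine (isUnit_toCompl w hbK).ne_zero ?_
  rw [← hv]
  exact zero_mul v

omit [IsNoetherianRing A] [Ring.DimensionLEOne A] in
lemma exists_smul_mem_range_of_fg
    {J : Submodule (AdicCompletion w A) (AdicCompletion w A ⊗[A] K)} (hJ : J.FG) :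
    ∃ n : A, n ≠ 0 ∧ ∀ u ∈ J, ∃ r : AdicCompletion w A,
      toCompl w (algebraMap A K n) * u = algebraMap _ _ r := by
  induction J, hJ using Submodule.fg_induction with
  | singleton x =>
    obtain ⟨n, hn, r, hr⟩ := exists_smul_mem_range w x
    refine ⟨n, hn, fun u hu => ?_⟩
    obtain ⟨t, rfl⟩ := Submodule.mem_span_singleton.1 hu
    exact ⟨t * r, by rw [mul_smul_comm, hr, compl_smul_def, map_mul]⟩
  | sup M N _ _ hM hN =>
    obtain ⟨m, hm, hM⟩ := hM
    obtain ⟨n, hn, hN⟩ := hN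
    refine ⟨m * n, mul_ne_zero hm hn, fun u hu => ?_⟩
    obtain ⟨y, hy, z, hz, rfl⟩ := Submodule.mem_sup.1 hu
    obtain ⟨r, hr⟩ := hM y hy
    obtain ⟨s, hs⟩ := hN z hz
    refine ⟨algebraMap A _ n * r + algebraMap A _ m * s, ?_⟩
    simp only [map_mul, map_add, ← hr, ← hs, ← toCompl_algebraMap]
    ring

lemma exists_locAt_eq [w.IsMaximal] (hw : w ≠ ⊥)
    {J : Submodule (AdicCompletion w A) (AdicCompletion w A ⊗[A] K)} (hJ : J.FG)
    {x : AdicCompletion w A ⊗[A] K} (hx : x ∈ J) (hx0 : x ∈ nonZeroDivisors _) :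
    ∃ M : Submodule A K, M.FG ∧ M ≠ ⊥ ∧ locAt w M = J := by
  obtain ⟨n, hn, r, hr⟩ := exists_smul_mem_range w x
  have hnK : algebraMap A K n ≠ 0 := by simpa using hn
  have hr0 : r ∈ nonZeroDivisors (AdicCompletion w A) := by
    refine mem_nonZeroDivisors_of_injective (algebraMap_compl_injective (K := K) w) ?_
    rw [← hr]
    exact mul_mem (isUnit_toCompl w hnK).mem_nonZeroDivisors hx0
  obtain ⟨d, hd, t, ht⟩ := exists_dvd_algebraMap w hw hr0
  have hdJ : ∀ s : AdicCompletion w A,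
      algebraMap _ (AdicCompletion w A ⊗[A] K) (algebraMap A _ d * s) ∈ J := by
    intro s
    have h1 : algebraMap _ (AdicCompletion w A ⊗[A] K) (algebraMap A _ d * s) =
        (algebraMap A _ n * t * s) • x := by
      rw [ht, compl_smul_def]
      simp only [map_mul, ← hr, ← toCompl_algebraMap]
      ring
    rw [h1]
    exact J.smul_mem _ hx
  obtain ⟨e, he, hint⟩ := exists_smul_mem_range_of_fg w hJ
  let M : Submodule A K :=
    (J.restrictScalars A).comap (toCompl w).toLinearMap ⊓
      (1 : Submodule A K).comap (e • LinearMap.id)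
  have hM : ∀ y, y ∈ M ↔ toCompl w y ∈ J ∧ ∃ a : A, e • y = algebraMap A K a := by
    intro y
    simp [M, Submodule.mem_one, eq_comm]
  have hdM : algebraMap A K d ∈ M := by
    refine (hM _).2 ⟨?_, e * d, by rw [Algebra.smul_def, map_mul]⟩
    have := hdJ 1
    rwa [mul_one, ← toCompl_algebraMap] at this
  refine ⟨M, fg_of_smul_integral he fun x hx => ((hM x).1 hx).2, ?_, le_antisymm ?_ ?_⟩
  · intro h
    rw [h, Submodule.mem_bot] at hdM
    exact hd (by simpa using hdM)
  · rw [locAt_le_iff]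
    exact fun y hy => ((hM y).1 hy).1
  · intro u hu
    obtain ⟨y, s, hs⟩ := exists_sub_toCompl w hd u
    have hyJ : toCompl w y ∈ J := by
      have := sub_mem hu (hs ▸ hdJ s)
      rwa [sub_sub_cancel] at this
    obtain ⟨q, hq⟩ := hint _ hyJ
    rw [← map_mul] at hq
    obtain ⟨f, hf, c, hc⟩ := exists_smul_eq_of_toCompl w one_ne_zero (r := q)
      (by rw [hq, map_one, one_mul])
    have hfy : f • y ∈ M := by
      refine (hM _).2 ⟨by rw [toCompl_smul]; exact J.smul_mem _ hyJ, 1 * c, ?_⟩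
      rw [← hc, smul_comm, ← Algebra.smul_def]
    have h1 : toCompl w y ∈ locAt w M := by
      have h2 := toCompl_mem_locAt (w := w) hfy
      rw [toCompl_smul] at h2
      exact (Submodule.smul_mem_iff_of_isUnit _ (isUnit_algebraMap_of_notMem w hf)).1 h2
    rw [eq_add_of_sub_eq hs, mul_comm, map_mul, ← toCompl_algebraMap, ← compl_smul_def]
    exact add_mem (Submodule.smul_mem _ _ (toCompl_mem_locAt hdM)) h1

end FractionField

section LocalGlobal

variable {A : Type*} [CommRing A] {K : Type*} [Field K] [Algebra A K]

lemma mem_of_forall_isMaximal {N : Submodule A K} {x : K}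
    (h : ∀ w : Ideal A, w.IsMaximal → ∃ s ∉ w, s • x ∈ N) : x ∈ N := by
  by_contra hx
  have hD : N.comap (LinearMap.toSpanSingleton A K x) ≠ ⊤ := fun h =>
    hx (by simpa using (Ideal.eq_top_iff_one _).1 h)
  obtain ⟨w, hw, hle⟩ := Ideal.exists_le_maximal _ hD
  obtain ⟨s, hs, hsx⟩ := h w hw
  exact hs (hle hsx)

lemma finite_setOf_mem_isMaximal [IsDomain A] [IsNoetherianRing A] [Ring.DimensionLEOne A] {b : A}
    (hb : b ≠ 0) : {w : {w : Ideal A // w.IsMaximal} | b ∈ w.1}.Finite := by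
  refine Set.Finite.of_finite_image
    ((Ideal.finite_minimalPrimes_of_isNoetherianRing A (Ideal.span {b})).subset ?_)
    Subtype.val_injective.injOn
  rintro _ ⟨w, hw, rfl⟩
  refine ⟨⟨w.2.isPrime, (Ideal.span_singleton_le_iff_mem _).2 hw⟩, fun q ⟨hq, hbq⟩ hqw => ?_⟩
  have hbq' := (Ideal.span_singleton_le_iff_mem _).1 hbq
  have hq0 : q ≠ ⊥ := by
    rintro rfl
    exact hb hbq'
  have hqm : q.IsMaximal := Ring.DimensionLEOne.maximalOfPrime hq0 hq
  exact (hqm.eq_of_le w.2.ne_top hqw).ge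

variable [IsDomain A] [IsNoetherianRing A] [IsFractionRing A K] [Ring.DimensionLEOne A]

/-- A family of lattices, almost all equal to `A`, glues to a lattice with these localizations. -/
lemma exists_glue (M : {w : Ideal A // w.IsMaximal} → Submodule A K) (hfg : ∀ w, (M w).FG)
    (h0 : ∀ w, M w ≠ ⊥) (hfin : {w | M w ≠ 1}.Finite) :
    ∃ P : Submodule A K, P.FG ∧ P ≠ ⊥ ∧ (∀ w, ∀ x ∈ P, ∃ s ∉ w.1, s • x ∈ M w) ∧
      ∀ w, ∀ x ∈ M w, ∃ s ∉ w.1, s • x ∈ P := by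
  let P : Submodule A K :=
    { carrier := {y | ∀ w, ∃ s ∉ w.1, s • y ∈ M w}
      add_mem' := by
        intro x y hx hy w
        obtain ⟨s, hs, hsx⟩ := hx w
        obtain ⟨t, ht, hty⟩ := hy w
        refine ⟨s * t, w.2.isPrime.mul_notMem hs ht, ?_⟩
        rw [smul_add, mul_smul s t y, mul_comm, mul_smul]
        exact add_mem ((M w).smul_mem _ hsx) ((M w).smul_mem _ hty)
      zero_mem' := fun w => ⟨1, (Ideal.ne_top_iff_one _).1 w.2.ne_top, by simp⟩
      smul_mem' := by
        intro a x hx w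
        obtain ⟨s, hs, hsx⟩ := hx w
        exact ⟨s, hs, by rw [smul_comm]; exact (M w).smul_mem _ hsx⟩ }
  have hsurj : ∀ w, ∀ x ∈ M w, ∃ s ∉ w.1, s • x ∈ P := by
    intro w x hx
    obtain ⟨a, b, hb, rfl⟩ := IsFractionRing.div_surjective (A := A) x
    have hb0 : b ≠ 0 := nonZeroDivisors.ne_zero hb
    have hbK : algebraMap A K b ≠ 0 := by simpa using hb0
    have hbx : b • (algebraMap A K a / algebraMap A K b) = algebraMap A K a := by
      rw [Algebra.smul_def, mul_div_cancel₀ _ hbK]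
    set x := algebraMap A K a / algebraMap A K b
    have key : ∀ w' : {w : Ideal A // w.IsMaximal}, ∃ z : A, (w' ≠ w → z ∉ w.1) ∧
        ∃ t ∉ w'.1, t • z • x ∈ M w' := by
      intro w'
      obtain ⟨d, hd, hdM⟩ := exists_algebraMap_mem (h0 w')
      have := w'.2
      obtain ⟨N, t, ht, hN⟩ := exists_pow_dvd w'.1 (mul_ne_zero hb0 hd)
      have hz : ∃ z ∈ w'.1 ^ N, w' ≠ w → z ∉ w.1 := by
        by_cases hww : w' = w
        · exact ⟨0, zero_mem _, fun h => (h hww).elim⟩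
        · by_contra! hcon
          have hle : w'.1 ^ N ≤ w.1 := fun z hz => (hcon z hz).2
          exact hww (Subtype.ext (w'.2.eq_of_le w.2.ne_top (w.2.isPrime.le_of_pow_le hle)))
      obtain ⟨z, hzN, hzw⟩ := hz
      refine ⟨z, hzw, t, ht, ?_⟩
      obtain ⟨c, hc⟩ := hN z hzN
      have h1 : t • z • x = (c * a) • algebraMap A K d := by
        rw [← mul_smul, hc, show b * d * c = (d * c) * b by ring, mul_smul, hbx, Algebra.smul_def,
          Algebra.smul_def, ← map_mul, ← map_mul]
        congr 1
        ring
      rw [h1]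
      exact (M w').smul_mem _ hdM
    choose z hzw t ht hM using key
    have hT := hfin.union (finite_setOf_mem_isMaximal hb0)
    refine ⟨∏ w' ∈ hT.toFinset.erase w, z w', fun hmem => ?_, fun w' => ?_⟩
    · obtain ⟨w', hw', hz⟩ := w.2.isPrime.prod_mem_iff.1 hmem
      exact hzw w' (Finset.ne_of_mem_erase hw') hz
    · by_cases hww : w' = w
      · subst hww
        exact ⟨1, (Ideal.ne_top_iff_one _).1 w'.2.ne_top, by
          rw [one_smul]; exact (M w').smul_mem _ hx⟩
      by_cases hwT : w' ∈ hT.toFinset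
      · refine ⟨t w', ht w', ?_⟩
        rw [← Finset.prod_erase_mul _ _ (Finset.mem_erase.2 ⟨hww, hwT⟩), mul_smul, smul_comm]
        exact (M w').smul_mem _ (hM w')
      · simp only [Set.Finite.mem_toFinset, Set.mem_union, Set.mem_ofPred_eq, not_or, not_not] at hwT
        refine ⟨b, hwT.2, ?_⟩
        rw [smul_comm, hbx, hwT.1]
        exact Submodule.smul_mem _ _ (Submodule.algebraMap_mem _)
  refine ⟨P, ?_, ?_, fun w x hx => hx w, hsurj⟩
  · choose e he hint using fun w => exists_smul_integral (hfg w)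
    refine fg_of_smul_integral (e := ∏ w ∈ hfin.toFinset, e w)
      (Finset.prod_ne_zero_iff.2 fun w _ => he w) fun x hx => ?_
    suffices (∏ w ∈ hfin.toFinset, e w) • x ∈ (1 : Submodule A K) by
      obtain ⟨a, ha⟩ := Submodule.mem_one.1 this
      exact ⟨a, ha.symm⟩
    refine mem_of_forall_isMaximal fun w hw => ?_
    obtain ⟨s, hs, hsx⟩ := hx ⟨w, hw⟩
    refine ⟨s, hs, ?_⟩
    by_cases hM : M ⟨w, hw⟩ = 1
    · rw [smul_comm]
      exact Submodule.smul_mem _ _ (hM ▸ hsx)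
    · have hmem : (⟨w, hw⟩ : {w : Ideal A // w.IsMaximal}) ∈ hfin.toFinset := by simpa using hM
      obtain ⟨a, ha⟩ := hint _ _ hsx
      rw [← Finset.prod_erase_mul _ _ hmem, mul_smul, smul_comm, smul_comm s, ha]
      exact Submodule.smul_mem _ _ (Submodule.algebraMap_mem _)
  · rintro hP
    obtain ⟨w, hw⟩ := Ideal.exists_maximal A
    obtain ⟨x, hx, hx0⟩ := Submodule.exists_mem_ne_zero_of_ne_bot (h0 ⟨w, hw⟩)
    obtain ⟨s, hs, hsx⟩ := hsurj ⟨w, hw⟩ x hx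
    rw [hP, Submodule.mem_bot, Algebra.smul_def, mul_eq_zero] at hsx
    refine hsx.elim (fun h => hs ?_) hx0
    rw [(map_eq_zero_iff _ (IsFractionRing.injective A K)).1 h]
    exact zero_mem _

omit [IsDomain A] [IsNoetherianRing A] [Ring.DimensionLEOne A] in
/-- Lattices are principal at maximal ideals not containing the conductor of a Dedekind
overring. -/
lemma exists_principal_at (B : Type*) [CommRing B] [IsDedekindDomain B] [Algebra A B] [Algebra B K]
    [IsScalarTower A B K] [IsFractionRing B K] {c : A}
    (hc : ∀ b : B, ∃ a : A, c • algebraMap B K b = algebraMap A K a) {w : Ideal A} (hcw : c ∉ w)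
    {M : Submodule A K} (hM : M.FG) (hM0 : M ≠ ⊥) :
    ∃ m ∈ M, m ≠ 0 ∧ ∃ s ∉ w, ∀ x ∈ M, ∃ a : A, s • x = a • m := by
  have hfg : (Submodule.span B (M : Set K)).FG := by
    obtain ⟨s, rfl⟩ := hM
    exact ⟨s, (Submodule.span_span_of_tower A B _).symm⟩
  let I : FractionalIdeal (nonZeroDivisors B) K :=
    ⟨Submodule.span B (M : Set K), FractionalIdeal.isFractional_of_fg hfg⟩
  have hMI : ∀ x ∈ M, x ∈ I := fun x hx => Submodule.subset_span hx
  have hI0 : I ≠ 0 := by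
    obtain ⟨x, hx, hx0⟩ := Submodule.exists_mem_ne_zero_of_ne_bot hM0
    intro h
    have := hMI x hx
    rw [h, FractionalIdeal.mem_zero_iff] at this
    exact hx0 this
  have hII : I * I⁻¹ = 1 := mul_inv_cancel₀ hI0
  have hint : ∀ x ∈ M, ∀ q ∈ I⁻¹, ∃ a : A, c • (x * q) = algebraMap A K a := by
    intro x hx q hq
    have h1 : x * q ∈ I * I⁻¹ := FractionalIdeal.mul_mem_mul (hMI x hx) hq
    rw [hII, FractionalIdeal.mem_one_iff] at h1
    obtain ⟨b, hb⟩ := h1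
    rw [← hb]
    exact hc b
  have hex : ∃ m ∈ M, ∃ q ∈ I⁻¹, ∃ s ∉ w, c • (m * q) = algebraMap A K s := by
    by_contra! hcon
    have h1 : ∀ x ∈ Submodule.span B (M : Set K), ∀ q ∈ I⁻¹, ∃ a ∈ w,
        c • (x * q) = algebraMap A K a := by
      intro x hx
      induction hx using Submodule.span_induction with
      | mem x hx =>
        intro q hq
        obtain ⟨a, ha⟩ := hint x hx q hq
        exact ⟨a, by_contra fun h => hcon x hx q hq a h ha, ha⟩
      | zero => exact fun q _ => ⟨0, zero_mem _, by simp⟩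
      | add x y _ _ hx hy =>
        intro q hq
        obtain ⟨a, ha, hax⟩ := hx q hq
        obtain ⟨b, hb, hby⟩ := hy q hq
        exact ⟨a + b, add_mem ha hb, by rw [add_mul, smul_add, hax, hby, map_add]⟩
      | smul b x _ hx =>
        intro q hq
        obtain ⟨a, ha, hax⟩ := hx (b • q)
          (Submodule.smul_mem (I⁻¹ : FractionalIdeal _ K).coeToSubmodule b hq)
        exact ⟨a, ha, by rw [← hax, smul_mul_assoc, mul_smul_comm]⟩
    have h2 : ∀ z ∈ I * I⁻¹, ∃ a ∈ w, c • z = algebraMap A K a := by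
      intro z hz
      refine FractionalIdeal.mul_induction_on hz (fun x hx q hq => h1 x hx q hq) ?_
      rintro x y ⟨a, ha, hax⟩ ⟨b, hb, hby⟩
      exact ⟨a + b, add_mem ha hb, by rw [smul_add, hax, hby, map_add]⟩
    rw [hII] at h2
    obtain ⟨a, ha, hac⟩ := h2 1 (FractionalIdeal.one_mem_one _)
    rw [← Algebra.algebraMap_eq_smul_one] at hac
    exact hcw (IsFractionRing.injective A K hac ▸ ha)
  obtain ⟨m, hm, q, hq, s, hs, hmq⟩ := hex
  refine ⟨m, hm, ?_, s, hs, fun x hx => ?_⟩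
  · rintro rfl
    rw [zero_mul, smul_zero, eq_comm, map_eq_zero_iff _ (IsFractionRing.injective A K)] at hmq
    exact hs (hmq ▸ zero_mem _)
  · obtain ⟨a, ha⟩ := hint x hx q hq
    refine ⟨a, ?_⟩
    rw [Algebra.smul_def, Algebra.smul_def, ← hmq, ← ha, Algebra.smul_def, Algebra.smul_def]
    ring

end LocalGlobal

section Lattices

variable {A : Type*} [CommRing A] {K : Type*} [Field K] [Algebra A K]

lemma exists_mem_locAt_nonZeroDivisors (w : Ideal A) {M : Submodule A K} (hM : M ≠ ⊥) :
    ∃ x ∈ locAt w M, x ∈ nonZeroDivisors (AdicCompletion w A ⊗[A] K) := by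
  obtain ⟨x, hx, hx0⟩ := Submodule.exists_mem_ne_zero_of_ne_bot hM
  exact ⟨_, toCompl_mem_locAt hx, (isUnit_toCompl w hx0).mem_nonZeroDivisors⟩

lemma map_mulLeft_one_locAt (w : Ideal A) (M : Submodule A K) :
    (locAt w M).map (LinearMap.mulLeft (AdicCompletion w A) 1) = locAt w M := by
  rw [LinearMap.mulLeft_one, Submodule.map_id]

variable [IsNoetherianRing A]

lemma locAt_eq_one_of_notMem {M : Submodule A K} {d e : A} (hd : algebraMap A K d ∈ M)
    (he : ∀ x ∈ M, ∃ a : A, e • x = algebraMap A K a) {w : Ideal A} [w.IsMaximal]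
    (hw : e * d ∉ w) : locAt w M = locAt w (1 : Submodule A K) := by
  refine le_antisymm (locAt_mono_of_local w fun x hx => ?_) (locAt_mono_of_local w fun x hx => ?_)
  · obtain ⟨a, ha⟩ := he x hx
    exact ⟨e, fun h => hw (w.mul_mem_right _ h), ha ▸ Submodule.algebraMap_mem a⟩
  · obtain ⟨a, rfl⟩ := Submodule.mem_one.1 hx
    refine ⟨d, fun h => hw (w.mul_mem_left _ h), ?_⟩
    rw [Algebra.smul_def, mul_comm, ← Algebra.smul_def]
    exact M.smul_mem _ hd

variable [IsFractionRing A K]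

/-- Multiplication by an invertible lattice is locally multiplication by a scalar. -/
lemma exists_unit_locAt_mul (w : Ideal A) [w.IsMaximal] {P Q : Submodule A K} (hPQ : P * Q = 1)
    (I : Submodule A K) : ∃ u : (AdicCompletion w A ⊗[A] K)ˣ,
      (locAt w I).map (LinearMap.mulLeft (AdicCompletion w A)
        (u : AdicCompletion w A ⊗[A] K)) = locAt w (P * I) := by
  have hint : ∀ p ∈ P, ∀ q ∈ Q, ∃ a : A, algebraMap A K a = p * q := fun p hp q hq =>
    Submodule.mem_one.1 (hPQ ▸ Submodule.mul_mem_mul hp hq)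
  have hex : ∃ p ∈ P, ∃ q ∈ Q, ∃ s ∉ w, p * q = algebraMap A K s := by
    by_contra! hcon
    have h1 : P * Q ≤ Submodule.map (Algebra.linearMap A K) w := by
      rw [Submodule.mul_le]
      intro p hp q hq
      obtain ⟨a, ha⟩ := hint p hp q hq
      exact ⟨a, by_contra fun h => hcon p hp q hq a h ha.symm, ha⟩
    obtain ⟨a, ha, ha1⟩ := h1 (hPQ ▸ Submodule.one_le.1 le_rfl)
    have ha1' : algebraMap A K a = algebraMap A K 1 := by rw [map_one]; exact ha1
    rw [IsFractionRing.injective A K ha1'] at ha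
    exact (Ideal.ne_top_iff_one w).1 (Ideal.IsMaximal.ne_top ‹_›) ha
  obtain ⟨p, hp, q, hq, s, hs, hpq⟩ := hex
  have hp0 : p ≠ 0 := by
    rintro rfl
    rw [zero_mul, eq_comm, map_eq_zero_iff _ (IsFractionRing.injective A K)] at hpq
    exact hs (hpq ▸ zero_mem _)
  refine ⟨(isUnit_toCompl w hp0).unit, ?_⟩
  rw [IsUnit.unit_spec, map_mulLeft_locAt]
  refine le_antisymm (locAt_mono_of_local w ?_) (locAt_mono_of_local w fun x hx => ⟨s, hs, ?_⟩)
  · rintro _ ⟨y, hy, rfl⟩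
    refine ⟨1, (Ideal.ne_top_iff_one w).1 (Ideal.IsMaximal.ne_top ‹_›), ?_⟩
    rw [one_smul]
    exact Submodule.mul_mem_mul hp hy
  · induction hx using Submodule.mul_induction_on' with
    | mem_mul_mem p' hp' y hy =>
      obtain ⟨a, ha⟩ := hint p' hp' q hq
      refine ⟨a • y, I.smul_mem _ hy, ?_⟩
      rw [LinearMap.mulLeft_apply, Algebra.smul_def, Algebra.smul_def, ha, ← hpq]
      ring
    | add x _ y _ hx hy => rw [smul_add]; exact add_mem hx hy

variable [IsDomain A] [Ring.DimensionLEOne A]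

lemma finite_setOf_locAt_ne_one {M : Submodule A K} (hM : M.FG) (hM0 : M ≠ ⊥) :
    {w : {w : Ideal A // w.IsMaximal} | locAt w.1 M ≠ locAt w.1 (1 : Submodule A K)}.Finite := by
  obtain ⟨d, hd, hdM⟩ := exists_algebraMap_mem hM0
  obtain ⟨e, he, hint⟩ := exists_smul_integral hM
  refine (finite_setOf_mem_isMaximal (mul_ne_zero he hd)).subset fun w hw => ?_
  have := w.2
  exact by_contra fun h => hw (locAt_eq_one_of_notMem hdM hint h)

/-- Lattices in the same genus differ by an invertible lattice. -/
lemma exists_mul_eq_of_locAt {I J : Submodule A K} (hI : I.FG) (hI0 : I ≠ ⊥) (hJ : J.FG)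
    (hJ0 : J ≠ ⊥) (hA : ∀ w : Ideal A, w.IsMaximal → w ≠ ⊥)
    (h : ∀ w : {w : Ideal A // w.IsMaximal}, ∃ u : AdicCompletion w.1 A ⊗[A] K,
      (locAt w.1 I).map (LinearMap.mulLeft (AdicCompletion w.1 A) u) = locAt w.1 J) :
    ∃ P Q : Submodule A K, (P.FG ∧ P ≠ ⊥) ∧ (Q.FG ∧ Q ≠ ⊥) ∧ P * Q = 1 ∧ P * I = J := by
  have hx : ∀ w : {w : Ideal A // w.IsMaximal}, ∃ x : K, x ≠ 0 ∧
      locAt w.1 (I.map (LinearMap.mulLeft A x)) = locAt w.1 J ∧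
      (locAt w.1 I = locAt w.1 J → x = 1) := by
    intro w
    have := w.2
    by_cases hIJ : locAt w.1 I = locAt w.1 J
    · exact ⟨1, one_ne_zero, by rw [LinearMap.mulLeft_one, Submodule.map_id, hIJ], fun _ => rfl⟩
    · obtain ⟨u, hu⟩ := h w
      obtain ⟨x, hx0, hx⟩ := exists_locAt_scale_eq w.1 (hA _ w.2) hI hJ hJ0 hu
      exact ⟨x, hx0, hx, fun h => (hIJ h).elim⟩
  choose x hx0 hx hx1 using hx
  have hfin : {w | x w ≠ 1}.Finite := by
    refine ((finite_setOf_locAt_ne_one hI hI0).union (finite_setOf_locAt_ne_one hJ hJ0)).subset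
      fun w hw => ?_
    by_contra hcon
    simp only [Set.mem_union, Set.mem_ofPred_eq, not_or, not_not] at hcon
    exact hw (hx1 w (hcon.1.trans hcon.2.symm))
  have hIJ : ∀ w, ∀ y ∈ I, ∃ s ∉ w.1, s • (x w * y) ∈ J := by
    intro w y hy
    have := w.2
    refine exists_smul_mem_of_toCompl_mem w.1 hJ hJ0 ?_
    rw [← hx w]
    exact toCompl_mem_locAt ⟨y, hy, rfl⟩
  have hJI : ∀ w, ∀ z ∈ J, ∃ s ∉ w.1, ∃ y ∈ I, x w * y = s • z := by
    intro w z hz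
    have := w.2
    refine exists_smul_mem_of_toCompl_mem w.1 (hI.map (LinearMap.mulLeft A (x w))) ?_ ?_
    · obtain ⟨y, hy, hy0⟩ := Submodule.exists_mem_ne_zero_of_ne_bot hI0
      exact (Submodule.ne_bot_iff _).2 ⟨x w * y, ⟨y, hy, rfl⟩, mul_ne_zero (hx0 w) hy0⟩
    · rw [hx w]
      exact toCompl_mem_locAt hz
  obtain ⟨P, hPfg, hP0, hP1, hP2⟩ := exists_glue (fun w => A ∙ x w)
    (fun w => Submodule.fg_span_singleton _)
    (fun w => by simpa using hx0 w)
    (hfin.subset fun w hw h => hw (by rw [h, Submodule.one_eq_span]))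
  obtain ⟨Q, hQfg, hQ0, hQ1, hQ2⟩ := exists_glue (fun w => A ∙ (x w)⁻¹)
    (fun w => Submodule.fg_span_singleton _)
    (fun w => by simpa using hx0 w)
    (hfin.subset fun w hw h => hw (by rw [h, inv_one, Submodule.one_eq_span]))
  refine ⟨P, Q, ⟨hPfg, hP0⟩, ⟨hQfg, hQ0⟩, le_antisymm ?_ ?_, le_antisymm ?_ ?_⟩
  · rw [Submodule.mul_le]
    refine fun p hp q hq => mem_of_forall_isMaximal fun w hw => ?_
    obtain ⟨s, hs, hsp⟩ := hP1 ⟨w, hw⟩ p hp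
    obtain ⟨t, ht, htq⟩ := hQ1 ⟨w, hw⟩ q hq
    obtain ⟨a, ha⟩ := Submodule.mem_span_singleton.1 hsp
    obtain ⟨b, hb⟩ := Submodule.mem_span_singleton.1 htq
    refine ⟨s * t, hw.isPrime.mul_notMem hs ht, Submodule.mem_one.2 ⟨a * b, ?_⟩⟩
    rw [← smul_mul_smul_comm, ← ha, ← hb, smul_mul_smul_comm, mul_inv_cancel₀ (hx0 _),
      Algebra.algebraMap_eq_smul_one]
  · rw [Submodule.one_le]
    refine mem_of_forall_isMaximal fun w hw => ?_
    obtain ⟨s, hs, hsp⟩ := hP2 ⟨w, hw⟩ _ (Submodule.mem_span_singleton_self _)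
    obtain ⟨t, ht, htq⟩ := hQ2 ⟨w, hw⟩ _ (Submodule.mem_span_singleton_self _)
    refine ⟨s * t, hw.isPrime.mul_notMem hs ht, ?_⟩
    rw [← mul_inv_cancel₀ (hx0 ⟨w, hw⟩), ← smul_mul_smul_comm]
    exact Submodule.mul_mem_mul hsp htq
  · rw [Submodule.mul_le]
    refine fun p hp y hy => mem_of_forall_isMaximal fun w hw => ?_
    obtain ⟨s, hs, hsp⟩ := hP1 ⟨w, hw⟩ p hp
    obtain ⟨t, ht, hty⟩ := hIJ ⟨w, hw⟩ y hy
    obtain ⟨a, ha⟩ := Submodule.mem_span_singleton.1 hsp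
    refine ⟨s * t, hw.isPrime.mul_notMem hs ht, ?_⟩
    rw [← smul_mul_smul_comm, ← ha, smul_mul_smul_comm, mul_smul]
    exact J.smul_mem _ hty
  · refine fun z hz => mem_of_forall_isMaximal fun w hw => ?_
    obtain ⟨s, hs, y, hy, hsz⟩ := hJI ⟨w, hw⟩ z hz
    obtain ⟨t, ht, htx⟩ := hP2 ⟨w, hw⟩ _ (Submodule.mem_span_singleton_self _)
    refine ⟨t * s, hw.isPrime.mul_notMem ht hs, ?_⟩
    rw [mul_smul, ← hsz, ← smul_mul_assoc]
    exact Submodule.mul_mem_mul htx hy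

/-- Every family of local lattices comes, up to units, from a global one. -/
lemma exists_locAt_eq_family (B : Type*) [CommRing B] [IsDedekindDomain B] [Algebra A B]
    [Algebra B K] [IsScalarTower A B K] [IsFractionRing B K] {c : A} (hc0 : c ≠ 0)
    (hc : ∀ b : B, ∃ a : A, c • algebraMap B K b = algebraMap A K a)
    (hA : ∀ w : Ideal A, w.IsMaximal → w ≠ ⊥)
    (J : (w : {w : Ideal A // w.IsMaximal}) →
      Submodule (AdicCompletion w.1 A) (AdicCompletion w.1 A ⊗[A] K))
    (hJ : ∀ w, (J w).FG) (hJ0 : ∀ w, ∃ x ∈ J w, x ∈ nonZeroDivisors _) :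
    ∃ P : Submodule A K, P.FG ∧ P ≠ ⊥ ∧ ∀ w : {w : Ideal A // w.IsMaximal},
      ∃ u : (AdicCompletion w.1 A ⊗[A] K)ˣ,
      (locAt w.1 P).map (LinearMap.mulLeft (AdicCompletion w.1 A)
        (u : AdicCompletion w.1 A ⊗[A] K)) = J w := by
  have hloc : ∀ w, ∃ M : Submodule A K, M.FG ∧ M ≠ ⊥ ∧ locAt w.1 M = J w := by
    intro w
    have := w.2
    obtain ⟨x, hx, hx0⟩ := hJ0 w
    exact exists_locAt_eq w.1 (hA _ w.2) (hJ w) hx hx0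
  choose M hM hM0 hMJ using hloc
  obtain ⟨P, hP, hP0, hP1, hP2⟩ := exists_glue (fun w => if c ∈ w.1 then M w else 1)
    (fun w => by
      split_ifs
      · exact hM w
      · exact Submodule.one_eq_span (R := A) (A := K) ▸ Submodule.fg_span_singleton _)
    (fun w => by
      split_ifs
      · exact hM0 w
      · exact one_ne_zero)
    ((finite_setOf_mem_isMaximal hc0).subset fun w hw => by_contra fun h => hw (if_neg h))
  refine ⟨P, hP, hP0, fun w => ?_⟩
  have := w.2
  have hPw := le_antisymm (locAt_mono_of_local w.1 (hP1 w)) (locAt_mono_of_local w.1 (hP2 w))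
  rw [hPw]
  split_ifs with hcw
  · exact ⟨1, by rw [Units.val_one, map_mulLeft_one_locAt, hMJ]⟩
  · obtain ⟨m, hm, hm0, s, hs, hsm⟩ := exists_principal_at B hc hcw (hM w) (hM0 w)
    refine ⟨(isUnit_toCompl w.1 hm0).unit, ?_⟩
    rw [IsUnit.unit_spec, map_mulLeft_locAt, ← hMJ]
    refine le_antisymm (locAt_mono_of_local w.1 ?_) (locAt_mono_of_local w.1 fun x hx => ⟨s, hs, ?_⟩)
    · rintro _ ⟨y, hy, rfl⟩
      obtain ⟨a, rfl⟩ := Submodule.mem_one.1 hy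
      refine ⟨1, (Ideal.ne_top_iff_one _).1 w.2.ne_top, ?_⟩
      rw [one_smul, LinearMap.mulLeft_apply, mul_comm, ← Algebra.smul_def]
      exact (M w).smul_mem _ hm
    · obtain ⟨a, ha⟩ := hsm x hx
      refine ⟨algebraMap A K a, Submodule.algebraMap_mem a, ?_⟩
      rw [ha, LinearMap.mulLeft_apply, Algebra.smul_def, mul_comm]

end Lattices

namespace PaperGlobal

variable (E : Type*) [Field E] [NumberField E]

/-- An order of the number field `E`: a subring finitely generated as a `ℤ`-module
which spans `E` over `ℚ` (such a subring is automatically contained in `𝒪_E`). -/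
def IsOrder (O : Subalgebra ℤ E) : Prop :=
  (Subalgebra.toSubmodule O).FG ∧ Submodule.span ℚ (O : Set E) = ⊤

/-- Fractional `R`-ideals: nonzero finitely generated `R`-submodules of `E`. -/
def FracIdeal (R : Subalgebra ℤ E) : Type _ :=
  {I : Submodule R E // I ≠ ⊥ ∧ I.FG}

/-- scaling a submodule by an element of `E` -/
def scale (R : Subalgebra ℤ E) (x : E) (I : Submodule R E) : Submodule R E :=
  I.map (LinearMap.mulLeft (↥R) x)

/-- The ideal class monoid: fractional ideals modulo multiplication by `E^×`. -/
def ClBar (R : Subalgebra ℤ E) : Type _ :=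
  Quot (fun I J : FracIdeal E R => ∃ x : E, x ≠ 0 ∧ scale E R x I.1 = J.1)

/-- multiplier ring `(I : I) = {x ∈ E | xI ⊆ I}` -/
def mult (R : Subalgebra ℤ E) (I : Submodule R E) : Set E :=
  {x : E | ∀ y ∈ I, x * y ∈ I}

/-- `cl(𝒪) = {[I] ∈ ClBar(R) | (I : I) = 𝒪}` -/
def cl (R O : Subalgebra ℤ E) : Set (ClBar E R) :=
  {c | ∃ I : FracIdeal E R, c = Quot.mk _ I ∧ mult E R I.1 = (O : Set E)}

/-- an invertible fractional ideal: `I·J = R` for some fractional ideal `J` -/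
def IsInvertible (R : Subalgebra ℤ E) (I : Submodule R E) : Prop :=
  ∃ J : Submodule R E, (J ≠ ⊥ ∧ J.FG) ∧ I * J = 1

/-- two fractional ideals lie in the same `Cl(R)`-orbit iff they differ by
multiplication by an invertible fractional ideal -/
def PicRel (R : Subalgebra ℤ E) (I J : FracIdeal E R) : Prop :=
  ∃ P : Submodule R E, (P ≠ ⊥ ∧ P.FG) ∧ IsInvertible E R P ∧ P * I.1 = J.1

/-- the orbit space `Cl(R)∖ClBar(R)` -/
def ClQuot (R : Subalgebra ℤ E) : Type _ := Quot (PicRel E R)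

/-- the image of `cl(𝒪)` in the orbit space `Cl(R)∖ClBar(R)` -/
def clQ (R O : Subalgebra ℤ E) : Set (ClQuot E R) :=
  {c | ∃ I : FracIdeal E R, c = Quot.mk _ I ∧ mult E R I.1 = (O : Set E)}

/-- the conductor `𝔣(R) = {a ∈ 𝒪_E | a𝒪_E ⊆ R}`, as a subset of `E` -/
def conductorSet (R : Subalgebra ℤ E) : Set E :=
  {a : E | a ∈ integralClosure ℤ E ∧ ∀ b ∈ integralClosure ℤ E, a * b ∈ R}

/-- Bass order: every ideal is generated by two elements. -/
def IsBass (R : Subalgebra ℤ E) : Prop :=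
  ∀ I : Ideal R, ∃ a b : R, I = Ideal.span {a, b}

/-- the `w`-adic completion `R_w` of `R` -/
abbrev Rw (R : Subalgebra ℤ E) (w : Ideal R) : Type _ := AdicCompletion w R

/-- `E_w = E ⊗_R R_w`, the total ring of fractions of `R_w` -/
abbrev Ew (R : Subalgebra ℤ E) (w : Ideal R) : Type _ := Rw E R w ⊗[↥R] E

/-- the image of a fractional `R`-ideal in `E_w`: the `R_w`-span of `1 ⊗ I` -/
def localize (R : Subalgebra ℤ E) (w : Ideal R) (I : Submodule R E) :
    Submodule (Rw E R w) (Ew E R w) :=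
  Submodule.span (Rw E R w)
    ((fun x : E => (1 : Rw E R w) ⊗ₜ[↥R] x) '' (I : Set E))

/-- scaling a submodule of `E_w` by an element of `E_w` -/
def scaleLoc (R : Subalgebra ℤ E) (w : Ideal R) (u : Ew E R w)
    (I : Submodule (Rw E R w) (Ew E R w)) : Submodule (Rw E R w) (Ew E R w) :=
  I.map (LinearMap.mulLeft (Rw E R w) u)

/-- fractional `R_w`-ideals: finitely generated `R_w`-submodules of `E_w`
containing a non-zero-divisor -/
def FracIdealLoc (R : Subalgebra ℤ E) (w : Ideal R) : Type _ :=
  {I : Submodule (Rw E R w) (Ew E R w) //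
    I.FG ∧ ∃ x ∈ I, x ∈ nonZeroDivisors (Ew E R w)}

/-- the completion `𝒪_{E_w} = 𝒪_E ⊗_R R_w` of `𝒪_E`, inside `E_w` -/
def OEw (R : Subalgebra ℤ E) (w : Ideal R) : Subalgebra (Rw E R w) (Ew E R w) :=
  Algebra.adjoin (Rw E R w)
    ((fun x : E => (1 : Rw E R w) ⊗ₜ[↥R] x) '' (integralClosure ℤ E : Set E))

section Order

variable {E}

lemma IsOrder.finite {R : Subalgebra ℤ E} (hR : IsOrder E R) : Module.Finite ℤ R :=
  Module.Finite.iff_fg.2 hR.1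

lemma IsOrder.exists_mul_eq {R : Subalgebra ℤ E} (hR : IsOrder E R) (z : E) :
    ∃ y : R, y ≠ 0 ∧ ∃ x : R, (y : E) * z = x := by
  have hz : z ∈ Submodule.span ℚ (R : Set E) := hR.2 ▸ Submodule.mem_top
  induction hz using Submodule.span_induction with
  | mem x hx => exact ⟨1, one_ne_zero, ⟨x, hx⟩, by simp⟩
  | zero => exact ⟨1, one_ne_zero, 0, by simp⟩
  | add u v _ _ hu hv =>
    obtain ⟨a, ha, x, hx⟩ := hu
    obtain ⟨b, hb, y, hy⟩ := hv
    refine ⟨a * b, mul_ne_zero ha hb, b * x + a * y, ?_⟩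
    push_cast
    rw [← hx, ← hy]
    ring
  | smul q v _ hv =>
    obtain ⟨a, ha, x, hx⟩ := hv
    have hq : (q.den : R) ≠ 0 := Nat.cast_ne_zero.2 q.den_ne_zero
    refine ⟨q.den * a, mul_ne_zero hq ha, q.num * x, ?_⟩
    have h1 : (q.den : E) * (q : E) = q.num := by exact_mod_cast Rat.den_mul_eq_num q
    push_cast
    rw [← hx, Rat.smul_def, ← h1]
    ring

lemma IsOrder.isFractionRing {R : Subalgebra ℤ E} (hR : IsOrder E R) : IsFractionRing R E := by
  refine IsFractionRing.of_field R E fun z => ?_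
  obtain ⟨y, hy, x, hx⟩ := hR.exists_mul_eq z
  have hy' : (y : E) ≠ 0 := by simpa using hy
  exact ⟨x, y, eq_div_of_mul_eq hy' (by rw [mul_comm]; exact hx)⟩

lemma IsOrder.ne_bot {R : Subalgebra ℤ E} (hR : IsOrder E R) {w : Ideal R} (hw : w.IsMaximal) :
    w ≠ ⊥ := by
  rintro rfl
  have := hR.finite
  exact Int.not_isField (isField_of_isIntegral_of_isField (S := R)
    (FaithfulSMul.algebraMap_injective ℤ R)
    (Ring.isField_iff_maximal_bot.2 hw))

open NumberField in
/-- A nonzero element of `R` multiplying `𝒪_E` into `R`, for an order `R`. -/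
lemma exists_smul_ringOfIntegers {R : Subalgebra ℤ E} [Algebra R (𝓞 E)] [IsScalarTower R (𝓞 E) E]
    [IsFractionRing R E] :
    ∃ c : R, c ≠ 0 ∧ ∀ b : 𝓞 E, ∃ a : R, c • algebraMap (𝓞 E) E b = algebraMap R E a := by
  have : Module.Finite R (𝓞 E) := Module.Finite.of_restrictScalars_finite ℤ R (𝓞 E)
  obtain ⟨c, hc, h⟩ := exists_smul_integral (A := R)
    (Module.Finite.iff_fg.1 (Module.Finite.range (IsScalarTower.toAlgHom R (𝓞 E) E).toLinearMap))
  exact ⟨c, hc, fun b => h _ ⟨b, rfl⟩⟩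

end Order

/-- For an order `R` of a number field `E`, the map sending the
`Cl(R)`-orbit of the class of a fractional `R`-ideal `I` to the family of classes
`([I ⊗_R R_w])_w` over the maximal ideals `w` of `R` is a well-defined bijection
`Cl(R)∖ClBar(R) ≅ ∏_w ClBar(R_w)`.  Concretely:
(a) each localization `I·R_w ⊆ E_w` is a fractional `R_w`-ideal, and for all but
finitely many `w` it is equivalent to `R_w` itself (unit-scalings identify it
with the unit ideal);
(b) two fractional `R`-ideals have, for every `w`, localizations differing by a
unit of `E_w` iff they lie in the same `Cl(R)`-orbit (injectivity);
(c) every family of fractional `R_w`-ideals arises, up to units of `E_w`, from a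
single fractional `R`-ideal (surjectivity). -/
theorem statement16 (R : Subalgebra ℤ E) (hR : IsOrder E R) :
    (∀ I : FracIdeal E R, ∀ w : {w : Ideal R // w.IsMaximal},
        (localize E R w.1 I.1).FG ∧
        (∃ x ∈ localize E R w.1 I.1, x ∈ nonZeroDivisors (Ew E R w.1)) ∧
        {w' : {w : Ideal R // w.IsMaximal} |
          ∀ u : (Ew E R w'.1)ˣ,
            scaleLoc E R w'.1 (u : Ew E R w'.1) (localize E R w'.1 I.1)
              ≠ Submodule.span (Rw E R w'.1) {(1 : Ew E R w'.1)}}.Finite) ∧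
    (∀ I J : FracIdeal E R,
        (∀ w : {w : Ideal R // w.IsMaximal},
          ∃ u : (Ew E R w.1)ˣ,
            scaleLoc E R w.1 (u : Ew E R w.1) (localize E R w.1 I.1)
              = localize E R w.1 J.1) ↔ PicRel E R I J) ∧
    (∀ Jw : (w : {w : Ideal R // w.IsMaximal}) → FracIdealLoc E R w.1,
        ∃ I : FracIdeal E R, ∀ w : {w : Ideal R // w.IsMaximal},
          ∃ u : (Ew E R w.1)ˣ,
            scaleLoc E R w.1 (u : Ew E R w.1) (localize E R w.1 I.1) = (Jw w).1) := by
  have := hR.finite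
  have : IsNoetherianRing R := IsNoetherianRing.of_finite ℤ R
  have : Ring.DimensionLEOne R := Ring.DimensionLEOne.of_isIntegral ℤ R
  have := hR.isFractionRing
  have hA : ∀ w : Ideal R, w.IsMaximal → w ≠ ⊥ := fun w hw => hR.ne_bot hw
  refine ⟨fun I w => ⟨locAt_fg w.1 I.2.2, exists_mem_locAt_nonZeroDivisors w.1 I.2.1, ?_⟩,
    fun I J => ⟨fun h => ?_, ?_⟩, fun J => ?_⟩
  · refine (finite_setOf_locAt_ne_one I.2.2 I.2.1).subset fun w' hw' h => hw' 1 ?_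
    rw [← locAt_one, ← h]
    exact map_mulLeft_one_locAt w'.1 I.1
  · obtain ⟨P, Q, hP, hQ, hPQ, hPI⟩ := exists_mul_eq_of_locAt I.2.2 I.2.1 J.2.2 J.2.1 hA
      fun w => (h w).imp' Units.val fun _ hu => hu
    exact ⟨P, hP.symm, ⟨Q, hQ.symm, hPQ⟩, hPI⟩
  · rintro ⟨P, -, ⟨Q, -, hPQ⟩, hPI⟩ w
    have := w.2
    rw [← hPI]
    exact exists_unit_locAt_mul w.1 hPQ I.1
  · let : Algebra R (NumberField.RingOfIntegers E) :=
      (IsIntegralClosure.lift ℤ (NumberField.RingOfIntegers E) E (S := R)).toRingHom.toAlgebra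
    have : IsScalarTower R (NumberField.RingOfIntegers E) E :=
      .of_algebraMap_eq fun x => (IsIntegralClosure.algebraMap_lift ℤ _ E x).symm
    obtain ⟨c, hc0, hc⟩ := exists_smul_ringOfIntegers (R := R)
    obtain ⟨P, hP, hP0, h⟩ := exists_locAt_eq_family (NumberField.RingOfIntegers E) hc0 hc hA
      (fun w => (J w).1) (fun w => (J w).2.1) fun w => (J w).2.2
    exact ⟨⟨P, hP0, hP⟩, h⟩

end PaperGlobal
end
end

section
/- Let R be a Bass order of a number field E. Then every order R' of E with R ⊆ R' satisfies R' = ⟨R, 𝔣(R')⟩, the subring of 𝒪_E generated by R together with the conductor 𝔣(R') of R'; consequently the map R' ↦ 𝔣(R') from the set of overorders of R to the set of ideals of 𝒪_E is injective. -/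
open scoped Classical TensorProduct

set_option synthInstance.maxHeartbeats 1000000
set_option maxHeartbeats 1600000

noncomputable section

namespace PaperGlobal

variable (E : Type*) [Field E] [NumberField E]

variable {E}

theorem IsOrder.le_integralClosure {O : Subalgebra ℤ E} (hO : IsOrder E O) :
    O ≤ integralClosure ℤ E := fun x hx =>
  IsIntegral.of_mem_of_fg O hO.1 x hx

theorem IsOrder.exists_int_mul_mem {O : Subalgebra ℤ E} (hO : IsOrder E O) (x : E) :
    ∃ n : ℤ, n ≠ 0 ∧ (n : E) * x ∈ O := by
  have hx : x ∈ Submodule.span ℚ (O : Set E) := hO.2 ▸ Submodule.mem_top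
  induction hx using Submodule.span_induction with
  | mem x h => exact ⟨1, one_ne_zero, by simpa using h⟩
  | zero => exact ⟨1, one_ne_zero, by simp⟩
  | add x y _ _ hx hy =>
    obtain ⟨n, hn, hnx⟩ := hx
    obtain ⟨m, hm, hmy⟩ := hy
    refine ⟨n * m, mul_ne_zero hn hm, ?_⟩
    have h := O.add_mem (O.mul_mem (intCast_mem O m) hnx) (O.mul_mem (intCast_mem O n) hmy)
    convert h using 1
    push_cast
    ring
  | smul q x _ hx =>
    obtain ⟨n, hn, hnx⟩ := hx
    refine ⟨q.den * n, mul_ne_zero (by exact_mod_cast q.den_nz) hn, ?_⟩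
    have h := O.mul_mem (intCast_mem O q.num) hnx
    convert h using 1
    have hq : (q.den : E) * (q : E) = q.num := by
      exact_mod_cast congrArg (Rat.cast : ℚ → E) (Rat.den_mul_eq_num q)
    rw [Rat.smul_def, ← hq]
    push_cast
    ring

/-- A single nonzero integer multiplies the whole maximal order into a given order. -/
theorem IsOrder.exists_int_mul_integralClosure_le {O : Subalgebra ℤ E} (hO : IsOrder E O) :
    ∃ n : ℤ, n ≠ 0 ∧ ∀ x ∈ integralClosure ℤ E, (n : E) * x ∈ O := by
  choose n hn hnx using hO.exists_int_mul_mem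
  have hfin : Module.Finite ℤ (integralClosure ℤ E) :=
    inferInstanceAs (Module.Finite ℤ (NumberField.RingOfIntegers E))
  have hfg : (Subalgebra.toSubmodule (integralClosure ℤ E)).FG :=
    Module.Finite.iff_fg.mp hfin
  obtain ⟨S, hS⟩ := hfg
  refine ⟨∏ s ∈ S, n s, Finset.prod_ne_zero_iff.mpr fun s _ => hn s, fun x hx => ?_⟩
  rw [← Subalgebra.mem_toSubmodule, ← hS] at hx
  induction hx using Submodule.span_induction with
  | mem x h =>
    rw [← Finset.prod_erase_mul S n h]
    push_cast
    rw [mul_assoc]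
    refine O.mul_mem ?_ (hnx x)
    exact O.prod_mem fun s _ => intCast_mem O (n s)
  | zero => simp
  | add x y _ _ hx hy => rw [mul_add]; exact O.add_mem hx hy
  | smul k x _ hx =>
    rw [mul_smul_comm]
    exact O.smul_mem hx k

/-- Over a Bass order, the maximal order is generated by two elements as a module. -/
theorem IsBass.exists_integralClosure_generators {R : Subalgebra ℤ E} (hR : IsOrder E R)
    (hBass : IsBass E R) :
    ∃ a ∈ integralClosure ℤ E, ∃ b ∈ integralClosure ℤ E,
      ∀ x ∈ integralClosure ℤ E, ∃ r ∈ R, ∃ s ∈ R, x = r * a + s * b := by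
  obtain ⟨d, hd, hdR⟩ := hR.exists_int_mul_integralClosure_le
  have hdE : (d : E) ≠ 0 := by exact_mod_cast hd
  let I : Ideal R :=
    { carrier := {r | ∃ x ∈ integralClosure ℤ E, (r : E) = d * x}
      zero_mem' := ⟨0, zero_mem _, by simp⟩
      add_mem' := by
        rintro r s ⟨x, hx, hrx⟩ ⟨y, hy, hsy⟩
        exact ⟨x + y, add_mem hx hy, by simp [hrx, hsy, mul_add]⟩
      smul_mem' := by
        rintro c r ⟨x, hx, hrx⟩
        refine ⟨c * x, mul_mem (hR.le_integralClosure c.2) hx, ?_⟩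
        simp only [smul_eq_mul, MulMemClass.coe_mul, hrx]
        ring }
  obtain ⟨r, s, hI⟩ := hBass I
  obtain ⟨a, ha, hra⟩ : r ∈ I := hI ▸ Ideal.subset_span (by simp)
  obtain ⟨b, hb, hsb⟩ : s ∈ I := hI ▸ Ideal.subset_span (by simp)
  refine ⟨a, ha, b, hb, fun x hx => ?_⟩
  have hxI : (⟨d * x, hdR x hx⟩ : R) ∈ I := ⟨x, hx, rfl⟩
  rw [hI, Ideal.mem_span_pair] at hxI
  obtain ⟨u, v, huv⟩ := hxI
  refine ⟨u, u.2, v, v.2, mul_left_cancel₀ hdE ?_⟩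
  have h := congrArg (Subtype.val : R → E) huv
  simp only [AddMemClass.coe_add, MulMemClass.coe_mul, hra, hsb] at h
  rw [← h]
  ring

/-- Two elements of an order which generate the unit ideal of the maximal order are coprime. -/
theorem isCoprime_of_mul_add_mul_eq_one {R : Subalgebra ℤ E}
    (hR : R ≤ integralClosure ℤ E) (α β : R) {a b : E} (ha : a ∈ integralClosure ℤ E)
    (hb : b ∈ integralClosure ℤ E) (h : (α : E) * a + β * b = 1) : IsCoprime α β := by
  let f : R →+* integralClosure ℤ E := (Subalgebra.inclusion hR).toRingHom
  have hf : Function.Injective f := Subalgebra.inclusion_injective hR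
  have hint : f.IsIntegral := by
    have h₁ : (f.comp (algebraMap ℤ R)).IsIntegral := by
      rw [RingHom.ext_int (f.comp (algebraMap ℤ R)) (algebraMap ℤ (integralClosure ℤ E))]
      exact fun x => (integralClosure.isIntegral x : IsIntegral ℤ x)
    exact RingHom.IsIntegral.tower_top _ _ h₁
  have htop : (Ideal.span {α, β}).map f = ⊤ := by
    rw [Ideal.eq_top_iff_one, Ideal.map_span, Set.image_pair, Ideal.mem_span_pair]
    refine ⟨⟨a, ha⟩, ⟨b, hb⟩, Subtype.ext ?_⟩
    change a * (α : E) + b * (β : E) = 1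
    rw [← h]
    ring
  rw [Ideal.map_eq_top_iff f hf hint, Ideal.eq_top_iff_one, Ideal.mem_span_pair] at htop
  exact htop

/-- If `β 𝒪_E ⊆ R + R x`, then `β²` multiplies any overorder into `R` plus its conductor. -/
theorem exists_sq_mul_sub_mem_conductorSet {R R' : Subalgebra ℤ E} (hRR' : R ≤ R')
    (hR' : R' ≤ integralClosure ℤ E) {β x y : E} (hβ : β ∈ R) (hx : x ∈ integralClosure ℤ E)
    (hgen : ∀ z ∈ integralClosure ℤ E, ∃ r ∈ R, ∃ s ∈ R, β * z = r + s * x) (hy : y ∈ R') :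
    ∃ s ∈ R, β ^ 2 * y - s ∈ conductorSet E R' := by
  obtain ⟨r, hr, s, hs, hrs⟩ := hgen (y * x) (mul_mem (hR' hy) hx)
  have ht : β * y - s ∈ R' := sub_mem (mul_mem (hRR' hβ) hy) (hRR' hs)
  refine ⟨β * s, mul_mem hβ hs, hR' ?_, fun z hz => ?_⟩
  · convert mul_mem (hRR' hβ) ht using 1
    ring
  · obtain ⟨p, hp, q, hq, hpq⟩ := hgen z hz
    convert add_mem (mul_mem ht (hRR' hp)) (mul_mem (hRR' hq) (hRR' hr)) using 1
    linear_combination (β * y - s) * hpq + q * hrs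

theorem IsBass.exists_sub_mem_conductorSet {R R' : Subalgebra ℤ E} (hR : IsOrder E R)
    (hBass : IsBass E R) (hR' : IsOrder E R') (hRR' : R ≤ R') {y : E} (hy : y ∈ R') :
    ∃ s ∈ R, y - s ∈ conductorSet E R' := by
  obtain ⟨a, ha, b, hb, hab⟩ := hBass.exists_integralClosure_generators hR
  obtain ⟨α, hα, β, hβ, h1⟩ := hab 1 (one_mem _)
  obtain ⟨s, hs, hsc⟩ := exists_sq_mul_sub_mem_conductorSet hRR' hR'.le_integralClosure hβ ha
    (fun z hz => by
      obtain ⟨p, hp, q, hq, hz⟩ := hab z hz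
      exact ⟨q, hq, β * p - q * α, sub_mem (mul_mem hβ hp) (mul_mem hq hα), by
        linear_combination β * hz - q * h1⟩) hy
  obtain ⟨t, ht, htc⟩ := exists_sq_mul_sub_mem_conductorSet hRR' hR'.le_integralClosure hα hb
    (fun z hz => by
      obtain ⟨p, hp, q, hq, hz⟩ := hab z hz
      exact ⟨p, hp, α * q - p * β, sub_mem (mul_mem hα hq) (mul_mem hp hβ), by
        linear_combination α * hz - p * h1⟩) hy
  obtain ⟨u, v, huv⟩ := (isCoprime_of_mul_add_mul_eq_one hR.le_integralClosure
    ⟨α, hα⟩ ⟨β, hβ⟩ ha hb h1.symm).pow (m := 2) (n := 2)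
  have huv' : (u : E) * α ^ 2 + v * β ^ 2 = 1 := congrArg (Subtype.val : R → E) huv
  have hsplit : y - (u * t + v * s) = u * (α ^ 2 * y - t) + v * (β ^ 2 * y - s) := by
    linear_combination -y * huv'
  refine ⟨u * t + v * s, add_mem (mul_mem u.2 ht) (mul_mem v.2 hs), ?_⟩
  rw [hsplit]
  refine ⟨add_mem (mul_mem (hR.le_integralClosure u.2) htc.1)
    (mul_mem (hR.le_integralClosure v.2) hsc.1), fun z hz => ?_⟩
  rw [add_mul, mul_assoc, mul_assoc]
  exact add_mem (mul_mem (hRR' u.2) (htc.2 z hz)) (mul_mem (hRR' v.2) (hsc.2 z hz))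

theorem IsBass.eq_adjoin_conductorSet {R R' : Subalgebra ℤ E} (hR : IsOrder E R)
    (hBass : IsBass E R) (hR' : IsOrder E R') (hRR' : R ≤ R') :
    R' = Algebra.adjoin ℤ ((R : Set E) ∪ conductorSet E R') := by
  refine le_antisymm (fun y hy => ?_) (Algebra.adjoin_le (Set.union_subset hRR' fun x hx => ?_))
  · obtain ⟨s, hs, hsc⟩ := hBass.exists_sub_mem_conductorSet hR hR' hRR' hy
    rw [← sub_add_cancel y s]
    exact add_mem (Algebra.subset_adjoin (Or.inr hsc)) (Algebra.subset_adjoin (Or.inl hs))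
  · simpa using hx.2 1 (one_mem _)

variable (E)

/-- For a Bass order `R` of a number field `E`, every overorder `R'`
of `R` satisfies `R' = ⟨R, 𝔣(R')⟩`, the subring of `𝒪_E` generated by `R` and the
conductor `𝔣(R')`; consequently `R' ↦ 𝔣(R')` is injective on overorders of `R`. -/
theorem statement19 (R : Subalgebra ℤ E) (hR : IsOrder E R) (hBass : IsBass E R) :
    (∀ R' : Subalgebra ℤ E, IsOrder E R' → R ≤ R' →
        R' = Algebra.adjoin ℤ ((R : Set E) ∪ conductorSet E R')) ∧
      (∀ R' R'' : Subalgebra ℤ E, IsOrder E R' → R ≤ R' → IsOrder E R'' → R ≤ R'' →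
        conductorSet E R' = conductorSet E R'' → R' = R'') := by
  have key := fun R' hR' h => hBass.eq_adjoin_conductorSet (R' := R') hR hR' h
  refine ⟨key, fun R' R'' hR' h' hR'' h'' hc => ?_⟩
  rw [key R' hR' h', key R'' hR'' h'', hc]

end PaperGlobal
end
end
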